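/- As t → ∞, R₀(t) − R₁(α(t)) = (π/3)t^(-2) + (1/(2√2))π^(1/2)t^(-5/2) − (11/15)π²t^(-3) − (11/(6√2))π^(3/2)t^(-7/2) + (103π³/70 − 5π/8)t^(-4) + O(t^(-9/2)). -/

import Mathlib

open Real Filter Asymptotics

/-- `R₁(t) = √(t/(2π))`, the polar radius of the polar square root spiral. -/
noncomputable def R1 (t : ℝ) : ℝ := Real.sqrt (t / (2 * π))

/-- `R₀(t) = √(1 + t/(2π) + (1/√(1+4t²))·√(2t/π))`, the distance of the front-track
point from the origin. -/
noncomputable def R0 (t : ℝ) : ℝ :=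
  Real.sqrt (1 + t / (2 * π) + (1 / Real.sqrt (1 + 4 * t ^ 2)) * Real.sqrt (2 * t / π))

/-- `α(t) = t + 2π + arctan(2t/(1 + √(t/(2π))·√(1+4t²)))`. -/
noncomputable def α (t : ℝ) : ℝ :=
  t + 2 * π + Real.arctan (2 * t / (1 + Real.sqrt (t / (2 * π)) * Real.sqrt (1 + 4 * t ^ 2)))

namespace FrontAux

/-- bounded on `(0,1]` -/
def Bd (r : ℝ → ℝ) : Prop := ∃ C, ∀ x, 0 < x → x ≤ 1 → |r x| ≤ C

lemma Bd.const (k : ℝ) : Bd (fun _ => k) := ⟨|k|, fun _ _ _ => le_rfl⟩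
lemma Bd.id : Bd (fun x => x) := ⟨1, fun x h h1 => by rw [abs_of_pos h]; exact h1⟩
lemma Bd.add {f g : ℝ → ℝ} (hf : Bd f) (hg : Bd g) : Bd (fun x => f x + g x) := by
  obtain ⟨C, hC⟩ := hf
  obtain ⟨D, hD⟩ := hg
  exact ⟨C + D, fun x h h1 => (abs_add_le _ _).trans (add_le_add (hC x h h1) (hD x h h1))⟩
lemma Bd.mul {f g : ℝ → ℝ} (hf : Bd f) (hg : Bd g) : Bd (fun x => f x * g x) := by
  obtain ⟨C, hC⟩ := hf
  obtain ⟨D, hD⟩ := hg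
  refine ⟨C * D, fun x h h1 => ?_⟩
  rw [abs_mul]
  exact mul_le_mul (hC x h h1) (hD x h h1) (abs_nonneg _) ((abs_nonneg _).trans (hC x h h1))
lemma Bd.neg {f : ℝ → ℝ} (hf : Bd f) : Bd (fun x => - f x) := by
  obtain ⟨C, hC⟩ := hf
  exact ⟨C, fun x h h1 => by rw [abs_neg]; exact hC x h h1⟩
lemma Bd.sub {f g : ℝ → ℝ} (hf : Bd f) (hg : Bd g) : Bd (fun x => f x - g x) := by
  simpa only [sub_eq_add_neg] using hf.add hg.neg
lemma Bd.pow {f : ℝ → ℝ} (hf : Bd f) (n : ℕ) : Bd (fun x => f x ^ n) := by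
  induction n with
  | zero => simpa using Bd.const 1
  | succ n ih => simpa only [pow_succ] using ih.mul hf
lemma Bd.divc {f : ℝ → ℝ} (hf : Bd f) (k : ℝ) : Bd (fun x => f x / k) := by
  simpa only [div_eq_mul_inv] using hf.mul (Bd.const k⁻¹)
lemma Bd.unit {f : ℝ → ℝ} (h0 : ∀ x, 0 < x → 0 ≤ f x) (h1 : ∀ x, 0 < x → f x ≤ 1) : Bd f :=
  ⟨1, fun x h _ => by rw [abs_of_nonneg (h0 x h)]; exact h1 x h⟩

/-- Arctangent with Taylor remainder. -/
lemma arctan_taylor (u : ℝ) (hu : 0 < u) :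
    ∃ h : ℝ, 0 ≤ h ∧ h ≤ 1 ∧
      arctan u = u - u ^ 3 / 3 + u ^ 5 / 5 - u ^ 7 / 7 + u ^ 9 * h := by
  have hd1 : ∀ y : ℝ, HasDerivAt
      (fun y => arctan y - (y - y ^ 3 / 3 + y ^ 5 / 5 - y ^ 7 / 7)) (y ^ 8 / (1 + y ^ 2)) y := by
    intro y
    have hp : (1 + y ^ 2) ≠ 0 := by positivity
    have := (hasDerivAt_arctan y).sub
      ((((hasDerivAt_id y).sub ((hasDerivAt_pow 3 y).div_const 3)).add
        ((hasDerivAt_pow 5 y).div_const 5)).sub ((hasDerivAt_pow 7 y).div_const 7))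
    refine this.congr_deriv ?_
    field_simp
    norm_num
    ring
  have hd2 : ∀ y : ℝ, HasDerivAt
      (fun y => y ^ 9 - (arctan y - (y - y ^ 3 / 3 + y ^ 5 / 5 - y ^ 7 / 7)))
      (9 * y ^ 8 - y ^ 8 / (1 + y ^ 2)) y := by
    intro y
    refine ((hasDerivAt_pow 9 y).sub (hd1 y)).congr_deriv ?_
    norm_num
  have m1 : Monotone (fun y => arctan y - (y - y ^ 3 / 3 + y ^ 5 / 5 - y ^ 7 / 7)) := by
    apply monotone_of_deriv_nonneg (fun y => (hd1 y).differentiableAt)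
    intro y
    rw [(hd1 y).deriv]
    positivity
  have m2 : Monotone
      (fun y => y ^ 9 - (arctan y - (y - y ^ 3 / 3 + y ^ 5 / 5 - y ^ 7 / 7))) := by
    apply monotone_of_deriv_nonneg (fun y => (hd2 y).differentiableAt)
    intro y
    rw [(hd2 y).deriv]
    have h1 : y ^ 8 / (1 + y ^ 2) ≤ y ^ 8 :=
      div_le_self (by positivity) (by nlinarith [sq_nonneg y])
    have h2 : 0 ≤ y ^ 8 := by positivity
    linarith
  have a1 := m1 hu.le
  have a2 := m2 hu.le
  simp at a1 a2
  have hp : 0 < u ^ 9 := by positivity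
  refine ⟨(arctan u - (u - u ^ 3 / 3 + u ^ 5 / 5 - u ^ 7 / 7)) / u ^ 9, ?_, ?_, ?_⟩
  · apply div_nonneg _ hp.le
    linarith
  · rw [div_le_one hp]
    linarith
  · field_simp
    ring

lemma sqrt_taylor (a : ℝ) (ha : 0 ≤ a) :
    ∃ k : ℝ, 0 ≤ k ∧ k ≤ 1 ∧ √(1 + a) = 1 + a / 2 - a ^ 2 / 8 + a ^ 3 * k := by
  set S := √(1 + a) with hS
  have h1 : 1 ≤ S := Real.one_le_sqrt.mpr (by linarith)
  have h2 : S ^ 2 = 1 + a := Real.sq_sqrt (by linarith)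
  have h3 : a = S ^ 2 - 1 := by linarith
  refine ⟨(S + 3) / (8 * (S + 1) ^ 3), by positivity, ?_, ?_⟩
  · rw [div_le_one (by positivity)]
    nlinarith [pow_pos (by linarith : 0 < S) 3, pow_pos (by linarith : 0 < S) 2]
  · rw [h3]
    have : S + 1 ≠ 0 := by positivity
    field_simp
    ring

lemma invsqrt_taylor (x : ℝ) :
    ∃ r : ℝ, 0 ≤ r ∧ r ≤ 1 ∧ (√(1 + x ^ 4 / 4))⁻¹ = 1 - x ^ 4 / 8 + x ^ 8 * r := by
  have h0 : 0 ≤ x ^ 4 := by positivity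
  set s := √(1 + x ^ 4 / 4) with hS
  have h1 : 1 ≤ s := Real.one_le_sqrt.mpr (by linarith)
  have h2 : s ^ 2 = 1 + x ^ 4 / 4 := Real.sq_sqrt (by linarith)
  have h3 : x ^ 4 = 4 * (s ^ 2 - 1) := by linarith
  have h4 : x ^ 8 = (4 * (s ^ 2 - 1)) ^ 2 := by rw [← h3]; ring
  refine ⟨(s + 2) / (32 * s * (s + 1) ^ 2), by positivity, ?_, ?_⟩
  · rw [div_le_one (by positivity)]
    nlinarith [pow_pos (by linarith : 0 < s) 3, pow_pos (by linarith : 0 < s) 2]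
  · rw [h3, h4]
    have : s + 1 ≠ 0 := by positivity
    have : s ≠ 0 := by positivity
    field_simp
    ring

noncomputable def q (x : ℝ) : ℝ := (√(1 + x ^ 4 / 4))⁻¹
noncomputable def v (c x : ℝ) : ℝ := (1 + c * x ^ 3 * q x / 2)⁻¹
noncomputable def u (c x : ℝ) : ℝ := c * x * q x * v c x

lemma q_pos (x : ℝ) : 0 < q x := by unfold q; positivity
lemma q_le (x : ℝ) : q x ≤ 1 := by
  unfold q
  have h0 : 0 ≤ x ^ 4 := by positivity
  exact inv_le_one_of_one_le₀ (Real.one_le_sqrt.mpr (by linarith))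
lemma v_pos {c x : ℝ} (hc : 0 < c) (hx : 0 < x) : 0 < v c x := by
  have := q_pos x
  unfold v; positivity
lemma v_le {c x : ℝ} (hc : 0 < c) (hx : 0 < x) : v c x ≤ 1 := by
  have := q_pos x
  unfold v
  apply inv_le_one_of_one_le₀
  have : 0 ≤ c * x ^ 3 * q x / 2 := by positivity
  linarith
lemma u_pos {c x : ℝ} (hc : 0 < c) (hx : 0 < x) : 0 < u c x := by
  have := q_pos x
  have := v_pos hc hx
  unfold u; positivity
lemma v_eq {c x : ℝ} (hc : 0 < c) (hx : 0 < x) :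
    v c x = 1 - (c * x ^ 3 * q x / 2) + (c * x ^ 3 * q x / 2) ^ 2
      - (c * x ^ 3 * q x / 2) ^ 3 * v c x := by
  have h := q_pos x
  have hw : 0 < c * x ^ 3 * q x / 2 := by positivity
  unfold v
  generalize c * x ^ 3 * q x / 2 = w at *
  have : 1 + w ≠ 0 := by positivity
  field_simp
  ring
lemma Bd_q : Bd q := Bd.unit (fun x _ => (q_pos x).le) (fun x _ => q_le x)
lemma Bd_v {c : ℝ} (hc : 0 < c) : Bd (v c) :=
  Bd.unit (fun _ hx => (v_pos hc hx).le) (fun _ hx => v_le hc hx)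

lemma q_exp : ∃ r : ℝ → ℝ, Bd r ∧ ∀ x, q x = 1 - x ^ 4 / 8 + x ^ 8 * r x := by
  choose r h0 h1 h2 using invsqrt_taylor
  exact ⟨r, Bd.unit (fun x _ => h0 x) (fun x _ => h1 x), h2⟩

lemma u_exp {c : ℝ} (hc : 0 < c) : ∃ r : ℝ → ℝ, Bd r ∧ ∀ x, 0 < x →
    u c x = c * x - c ^ 2 * x ^ 4 / 2 - c * x ^ 5 / 8 + c ^ 3 * x ^ 7 / 4 + x ^ 8 * r x := by
  obtain ⟨r1, hr1, e1⟩ := q_exp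
  obtain ⟨q1, hq1, e2⟩ : ∃ q1 : ℝ → ℝ, Bd q1 ∧ ∀ x, q x = 1 + x ^ 4 * q1 x := by
    refine ⟨fun x => -(1 / 8) + x ^ 4 * r1 x,
      (Bd.const _).add ((Bd.id.pow 4).mul hr1), fun x => ?_⟩
    rw [e1]; ring
  refine ⟨fun x => c * x * r1 x - c ^ 2 / 2 * (q1 x * (1 + q x))
    + c ^ 3 / 4 * x ^ 3 * (q1 x * (1 + q x + q x ^ 2)) - c ^ 4 / 8 * x ^ 2 * (q x ^ 4 * v c x),
    ?_, fun x hx => ?_⟩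
  · have hq := Bd_q
    have hv := Bd_v hc
    exact (((((Bd.const c).mul Bd.id).mul hr1).sub
      ((Bd.const _).mul (hq1.mul ((Bd.const _).add hq)))).add
      (((Bd.const _).mul (Bd.id.pow 3)).mul
        (hq1.mul (((Bd.const _).add hq).add (hq.pow 2))))).sub
      (((Bd.const _).mul (Bd.id.pow 2)).mul ((hq.pow 4).mul hv))
  · have h1 : u c x = c * x * q x - c ^ 2 * x ^ 4 / 2 * q x ^ 2 + c ^ 3 * x ^ 7 / 4 * q x ^ 3
        - c ^ 4 * x ^ 10 / 8 * q x ^ 4 * v c x := by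
      have := v_eq hc hx
      unfold u
      linear_combination c * x * q x * this
    rw [h1]
    have a1 := e1 x
    have a2 := e2 x
    simp only
    linear_combination c * x * a1 + (- c ^ 2 * x ^ 4 / 2 * (1 + q x)
      + c ^ 3 * x ^ 7 / 4 * (1 + q x + q x ^ 2)) * a2

lemma arctan_exp {c : ℝ} (hc : 0 < c) : ∃ r : ℝ → ℝ, Bd r ∧ ∀ x, 0 < x →
    arctan (u c x) = c * x - c ^ 3 * x ^ 3 / 3 - c ^ 2 * x ^ 4 / 2 + (c ^ 5 / 5 - c / 8) * x ^ 5
      + c ^ 4 / 2 * x ^ 6 + (3 * c ^ 3 / 8 - c ^ 7 / 7) * x ^ 7 + x ^ 8 * r x := by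
  obtain ⟨r2, hr2, e1⟩ := u_exp hc
  have hh : ∀ x, ∃ h : ℝ, 0 < x → (0 ≤ h ∧ h ≤ 1 ∧
      arctan (u c x) = u c x - u c x ^ 3 / 3 + u c x ^ 5 / 5 - u c x ^ 7 / 7 + u c x ^ 9 * h) := by
    intro x
    by_cases hx : 0 < x
    · obtain ⟨h, hh⟩ := arctan_taylor _ (u_pos hc hx)
      exact ⟨h, fun _ => hh⟩
    · exact ⟨0, fun h => absurd h hx⟩
  choose h hh using hh
  have hB : Bd h := Bd.unit (fun x hx => (hh x hx).1) (fun x hx => (hh x hx).2.1)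
  obtain ⟨z1, hz1, d1⟩ : ∃ z1 : ℝ → ℝ, Bd z1 ∧ ∀ x, z1 x = c ^ 3 / 4 + x * r2 x :=
    ⟨_, (Bd.const _).add (Bd.id.mul hr2), fun x => rfl⟩
  obtain ⟨z2, hz2, d2⟩ : ∃ z2 : ℝ → ℝ, Bd z2 ∧
      ∀ x, z2 x = - (c ^ 2 / 2) - c / 8 * x + x ^ 3 * z1 x :=
    ⟨_, ((Bd.const _).sub ((Bd.const _).mul Bd.id)).add ((Bd.id.pow 3).mul hz1), fun x => rfl⟩
  obtain ⟨z, hz, d3⟩ : ∃ z : ℝ → ℝ, Bd z ∧ ∀ x, z x = c + x ^ 3 * z2 x :=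
    ⟨_, (Bd.const _).add ((Bd.id.pow 3).mul hz2), fun x => rfl⟩
  refine ⟨fun x => r2 x - (3 * c ^ 2 * x * z1 x + 3 * c * x * z2 x ^ 2 + x ^ 4 * z2 x ^ 3) / 3
    + z2 x * (z x ^ 4 + z x ^ 3 * c + z x ^ 2 * c ^ 2 + z x * c ^ 3 + c ^ 4) / 5
    - x ^ 2 * (z2 x * (z x ^ 6 + z x ^ 5 * c + z x ^ 4 * c ^ 2 + z x ^ 3 * c ^ 3 + z x ^ 2 * c ^ 4
      + z x * c ^ 5 + c ^ 6)) / 7 + x * (z x ^ 9 * h x), ?_, fun x hx => ?_⟩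
  · have k := Bd.const
    have X := Bd.id
    exact (((hr2.sub (((((k _).mul X).mul hz1).add (((k _).mul X).mul (hz2.pow 2))).add
      ((X.pow 4).mul (hz2.pow 3)) |>.divc 3)).add
      ((hz2.mul (((((hz.pow 4).add ((hz.pow 3).mul (k _))).add ((hz.pow 2).mul (k _))).add
        (hz.mul (k _))).add (k _))).divc 5)).sub
      (((X.pow 2).mul (hz2.mul (((((((hz.pow 6).add ((hz.pow 5).mul (k _))).add
        ((hz.pow 4).mul (k _))).add ((hz.pow 3).mul (k _))).add ((hz.pow 2).mul (k _))).add
        (hz.mul (k _))).add (k _)))).divc 7)).add (X.mul ((hz.pow 9).mul hB))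
  · have hu : u c x = x * z x := by
      rw [e1 x hx, d3, d2, d1]; ring
    have b3 : z x ^ 3 = c ^ 3 - 3 / 2 * c ^ 4 * x ^ 3 - 3 / 8 * c ^ 3 * x ^ 4
        + x ^ 5 * (3 * c ^ 2 * x * z1 x + 3 * c * x * z2 x ^ 2 + x ^ 4 * z2 x ^ 3) := by
      rw [d3]
      linear_combination 3 * c ^ 2 * x ^ 3 * d2 x
    have b5 : z x ^ 5 = c ^ 5 + x ^ 3 *
        (z2 x * (z x ^ 4 + z x ^ 3 * c + z x ^ 2 * c ^ 2 + z x * c ^ 3 + c ^ 4)) := by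
      linear_combination (z x ^ 4 + z x ^ 3 * c + z x ^ 2 * c ^ 2 + z x * c ^ 3 + c ^ 4) * d3 x
    have b7 : z x ^ 7 = c ^ 7 + x ^ 3 *
        (z2 x * (z x ^ 6 + z x ^ 5 * c + z x ^ 4 * c ^ 2 + z x ^ 3 * c ^ 3 + z x ^ 2 * c ^ 4
      + z x * c ^ 5 + c ^ 6)) := by
      linear_combination (z x ^ 6 + z x ^ 5 * c + z x ^ 4 * c ^ 2 + z x ^ 3 * c ^ 3
        + z x ^ 2 * c ^ 4 + z x * c ^ 5 + c ^ 6) * d3 x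
    have hA := (hh x hx).2.2
    have hE := e1 x hx
    have hA2 : arctan (u c x) = u c x - x ^ 3 * z x ^ 3 / 3 + x ^ 5 * z x ^ 5 / 5
        - x ^ 7 * z x ^ 7 / 7 + x ^ 9 * z x ^ 9 * h x := by
      rw [hA, hu]; ring
    simp only
    linear_combination hA2 + hE - x ^ 3 / 3 * b3 + x ^ 5 / 5 * b5 - x ^ 7 / 7 * b7

lemma sqrt_exp {c : ℝ} (a a1 : ℝ → ℝ) (h1 : Bd a1) (h0 : ∀ x, 0 < x → 0 ≤ a x)
    (ha : ∀ x, 0 < x → a x = c ^ 2 * x ^ 2 + c * x ^ 3 + x ^ 5 * a1 x) :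
    ∃ r : ℝ → ℝ, Bd r ∧ ∀ x, 0 < x → √(1 + a x) =
      1 + c ^ 2 * x ^ 2 / 2 + c * x ^ 3 / 2 - c ^ 4 * x ^ 4 / 8 + x ^ 5 * r x := by
  have hh : ∀ x, ∃ k : ℝ, 0 < x → (0 ≤ k ∧ k ≤ 1 ∧
      √(1 + a x) = 1 + a x / 2 - a x ^ 2 / 8 + a x ^ 3 * k) := by
    intro x
    by_cases hx : 0 < x
    · obtain ⟨h, hh⟩ := sqrt_taylor _ (h0 x hx)
      exact ⟨h, fun _ => hh⟩
    · exact ⟨0, fun h => absurd h hx⟩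
  choose k hk using hh
  have hB : Bd k := Bd.unit (fun x hx => (hk x hx).1) (fun x hx => (hk x hx).2.1)
  obtain ⟨a3, h3, d3⟩ : ∃ a3 : ℝ → ℝ, Bd a3 ∧ ∀ x, a3 x = c + x ^ 2 * a1 x :=
    ⟨_, (Bd.const _).add ((Bd.id.pow 2).mul h1), fun x => rfl⟩
  obtain ⟨a2, h2, d2⟩ : ∃ a2 : ℝ → ℝ, Bd a2 ∧ ∀ x, a2 x = c ^ 2 + x * a3 x :=
    ⟨_, (Bd.const _).add (Bd.id.mul h3), fun x => rfl⟩
  refine ⟨fun x => a1 x / 2 - a3 x * (c ^ 2 + a2 x) / 8 + x * (a2 x ^ 3 * k x), ?_,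
    fun x hx => ?_⟩
  · exact ((h1.divc 2).sub ((h3.mul ((Bd.const _).add h2)).divc 8)).add
      (Bd.id.mul ((h2.pow 3).mul hB))
  · have e : a x = x ^ 2 * a2 x := by rw [ha x hx, d2, d3]; ring
    have e2 := ha x hx
    have e3 : √(1 + a x) = 1 + a x / 2 - (x ^ 2 * a2 x) ^ 2 / 8 + (x ^ 2 * a2 x) ^ 3 * k x := by
      rw [(hk x hx).2.2, e]
    simp only
    linear_combination e3 + e2 / 2 - x ^ 4 / 8 * (a2 x + c ^ 2) * d2 x

noncomputable def T (c x : ℝ) : ℝ :=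
  c ^ 2 / 6 * x ^ 4 + c / 4 * x ^ 5 - 11 / 60 * c ^ 4 * x ^ 6 - 11 / 24 * c ^ 3 * x ^ 7
    + (103 * c ^ 6 / 560 - 5 * c ^ 2 / 16) * x ^ 8

lemma core {c : ℝ} (hc : 0 < c) : ∃ C : ℝ, ∀ x, 0 < x → x ≤ 1 →
    |(√(1 + (c ^ 2 * x ^ 2 + c * x ^ 3 * q x))
      - √(1 + (c ^ 2 * x ^ 2 + x ^ 2 * arctan (u c x)))) / (c * x) - T c x| ≤ C * x ^ 9 := by
  obtain ⟨r1, hr1, e1⟩ := q_exp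
  obtain ⟨r3, hr3, e3⟩ := arctan_exp hc
  have k := Bd.const
  have X := Bd.id
  obtain ⟨sA, hsA, eA⟩ := sqrt_exp (c := c) (fun x => c ^ 2 * x ^ 2 + c * x ^ 3 * q x)
    (fun x => c * x ^ 2 * (-(1 / 8) + x ^ 4 * r1 x))
    (((k _).mul (X.pow 2)).mul ((k _).add ((X.pow 4).mul hr1)))
    (fun x hx => by have := q_pos x; positivity)
    (fun x hx => by rw [e1]; ring)
  obtain ⟨sB, hsB, eB⟩ := sqrt_exp (c := c) (fun x => c ^ 2 * x ^ 2 + x ^ 2 * arctan (u c x))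
    (fun x => -(c ^ 3 / 3) - c ^ 2 / 2 * x + (c ^ 5 / 5 - c / 8) * x ^ 2
      + c ^ 4 / 2 * x ^ 3 + (3 * c ^ 3 / 8 - c ^ 7 / 7) * x ^ 4 + x ^ 5 * r3 x)
    ((((((k _).sub ((k _).mul X)).add ((k _).mul (X.pow 2))).add ((k _).mul (X.pow 3))).add
      ((k _).mul (X.pow 4))).add ((X.pow 5).mul hr3))
    (fun x hx => by
      have : 0 ≤ arctan (u c x) := Real.arctan_nonneg.mpr (u_pos hc hx).le
      positivity)
    (fun x hx => by rw [e3 x hx]; ring)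
  obtain ⟨ρ, hρ, dρ⟩ : ∃ ρ : ℝ → ℝ, Bd ρ ∧ ∀ x, ρ x =
      (c / 4 * (-(c ^ 4 / 4)) + (-(11 / 60 * c ^ 4)) * c + (-(11 / 24 * c ^ 3)) * c ^ 2)
      + ((-(11 / 60 * c ^ 4)) * (-(c ^ 4 / 4)) + (-(11 / 24 * c ^ 3)) * c
        + (103 * c ^ 6 / 560 - 5 * c ^ 2 / 16) * c ^ 2) * x
      + ((-(11 / 24 * c ^ 3)) * (-(c ^ 4 / 4)) + (103 * c ^ 6 / 560 - 5 * c ^ 2 / 16) * c) * x ^ 2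
      + ((103 * c ^ 6 / 560 - 5 * c ^ 2 / 16) * (-(c ^ 4 / 4))) * x ^ 3 :=
    ⟨_, (((k _).add ((k _).mul X)).add ((k _).mul (X.pow 2))).add ((k _).mul (X.pow 3)),
      fun x => rfl⟩
  obtain ⟨τ, hτ, dτ⟩ : ∃ τ : ℝ → ℝ, Bd τ ∧ ∀ x, τ x =
      c ^ 2 / 6 + c / 4 * x + (-(11 / 60 * c ^ 4)) * x ^ 2 + (-(11 / 24 * c ^ 3)) * x ^ 3
    + (103 * c ^ 6 / 560 - 5 * c ^ 2 / 16) * x ^ 4 :=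
    ⟨_, ((((k _).add ((k _).mul X)).add ((k _).mul (X.pow 2))).add ((k _).mul (X.pow 3))).add
      ((k _).mul (X.pow 4)), fun x => rfl⟩
  obtain ⟨E, hE, dE⟩ : ∃ E : ℝ → ℝ, Bd E ∧ ∀ x, E x =
      (c * x * r1 x - r3 x) / c - ρ x - τ x * (sA x + sB x) :=
    ⟨_, (((((((k _).mul X).mul hr1).sub hr3).divc c).sub hρ).sub (hτ.mul (hsA.add hsB))),
      fun x => rfl⟩
  obtain ⟨C, hC⟩ := hE
  refine ⟨C, fun x hx hx1 => ?_⟩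
  have fA := eA x hx
  have fB := eB x hx
  have pA : 0 ≤ c ^ 2 * x ^ 2 + c * x ^ 3 * q x := by have := q_pos x; positivity
  have pB : 0 ≤ c ^ 2 * x ^ 2 + x ^ 2 * arctan (u c x) := by
    have : 0 ≤ arctan (u c x) := Real.arctan_nonneg.mpr (u_pos hc hx).le
    positivity
  have qA : 1 ≤ √(1 + (c ^ 2 * x ^ 2 + c * x ^ 3 * q x)) :=
    Real.one_le_sqrt.mpr (by linarith)
  have qB : 1 ≤ √(1 + (c ^ 2 * x ^ 2 + x ^ 2 * arctan (u c x))) :=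
    Real.one_le_sqrt.mpr (by linarith)
  have rA := Real.sq_sqrt (by linarith : 0 ≤ 1 + (c ^ 2 * x ^ 2 + c * x ^ 3 * q x))
  have rB := Real.sq_sqrt (by linarith : 0 ≤ 1 + (c ^ 2 * x ^ 2 + x ^ 2 * arctan (u c x)))
  set A := √(1 + (c ^ 2 * x ^ 2 + c * x ^ 3 * q x))
  set B := √(1 + (c ^ 2 * x ^ 2 + x ^ 2 * arctan (u c x)))
  have hS : 1 ≤ A + B := by linarith
  have hT : T c x = x ^ 4 * τ x := by rw [dτ]; unfold T; ring
  have key : ((A - B) / (c * x) - T c x) * (A + B) = E x * x ^ 9 := by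
    have hD : (A - B) * (A + B) = c * x * (x ^ 4 * (c ^ 2 / 3 + c * x / 2 - c ^ 4 / 5 * x ^ 2
        - c ^ 3 / 2 * x ^ 3 - (3 * c ^ 2 / 8 - c ^ 6 / 7) * x ^ 4
        + x ^ 5 * ((c * x * r1 x - r3 x) / c))) := by
      have : c * ((c * x * r1 x - r3 x) / c) = c * x * r1 x - r3 x := by field_simp
      linear_combination rA - rB + c * x ^ 3 * e1 x - x ^ 2 * e3 x hx - x ^ 10 * this
    have hD2 : (A - B) / (c * x) * (A + B) = x ^ 4 * (c ^ 2 / 3 + c * x / 2 - c ^ 4 / 5 * x ^ 2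
        - c ^ 3 / 2 * x ^ 3 - (3 * c ^ 2 / 8 - c ^ 6 / 7) * x ^ 4
        + x ^ 5 * ((c * x * r1 x - r3 x) / c)) := by
      rw [div_mul_eq_mul_div, hD, mul_div_cancel_left₀]
      positivity
    have hST : τ x * (2 + c ^ 2 * x ^ 2 + c * x ^ 3 - c ^ 4 / 4 * x ^ 4) =
        c ^ 2 / 3 + c * x / 2 - c ^ 4 / 5 * x ^ 2
        - c ^ 3 / 2 * x ^ 3 - (3 * c ^ 2 / 8 - c ^ 6 / 7) * x ^ 4 + x ^ 5 * ρ x := by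
      rw [dτ, dρ]; ring
    rw [sub_mul, hD2, hT, dE]
    linear_combination - x ^ 4 * τ x * (fA + fB) - x ^ 4 * hST
  have hCx := hC x hx hx1
  calc |(A - B) / (c * x) - T c x| ≤ |(A - B) / (c * x) - T c x| * (A + B) :=
        le_mul_of_one_le_right (abs_nonneg _) hS
    _ = |E x| * x ^ 9 := by
        rw [← abs_of_pos (by linarith : 0 < A + B), ← abs_mul,
          key, abs_mul, abs_of_pos (by positivity : 0 < x ^ 9)]
    _ ≤ C * x ^ 9 := by gcongr

lemma sqrt_one_add {x : ℝ} (hx : 0 < x) :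
    √(1 + 4 * ((x ^ 2)⁻¹) ^ 2) = 2 * (x ^ 2)⁻¹ * √(1 + x ^ 4 / 4) := by
  have : 1 + 4 * ((x ^ 2)⁻¹) ^ 2 = (2 * (x ^ 2)⁻¹) ^ 2 * (1 + x ^ 4 / 4) := by
    field_simp
    ring
  rw [this, Real.sqrt_mul (by positivity), Real.sqrt_sq (by positivity)]

lemma sqrt_t {c x : ℝ} (hc : 0 < c) (hc2 : c ^ 2 = 2 * π) (hx : 0 < x) :
    √((x ^ 2)⁻¹ / (2 * π)) = (c * x)⁻¹ := by
  rw [← hc2, Real.sqrt_eq_iff_mul_self_eq_of_pos (by positivity)]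
  field_simp

lemma R0_eq {c x : ℝ} (hc : 0 < c) (hc2 : c ^ 2 = 2 * π) (hx : 0 < x) :
    R0 ((x ^ 2)⁻¹) = √(1 + (c ^ 2 * x ^ 2 + c * x ^ 3 * q x)) / (c * x) := by
  have h1 : √(2 * (x ^ 2)⁻¹ / π) = 2 * (c * x)⁻¹ := by
    have hp : π = c ^ 2 / 2 := by linarith
    rw [hp, Real.sqrt_eq_iff_mul_self_eq_of_pos (by positivity)]
    field_simp
  have hp : π = c ^ 2 / 2 := by linarith
  have hs : 0 < √(1 + x ^ 4 / 4) := by positivity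
  unfold R0
  rw [sqrt_one_add hx, h1]
  rw [eq_div_iff (by positivity), ← Real.sqrt_sq (by positivity : 0 ≤ c * x),
    ← Real.sqrt_mul' _ (by positivity), Real.sqrt_sq (by positivity : 0 ≤ c * x)]
  congr 1
  unfold q
  rw [hp]
  field_simp
  ring

lemma R1_eq {c x : ℝ} (hc : 0 < c) (hc2 : c ^ 2 = 2 * π) (hx : 0 < x) :
    R1 (α ((x ^ 2)⁻¹)) = √(1 + (c ^ 2 * x ^ 2 + x ^ 2 * arctan (u c x))) / (c * x) := by
  have hp : π = c ^ 2 / 2 := by linarith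
  have hs : 0 < √(1 + x ^ 4 / 4) := by positivity
  have hu : 2 * (x ^ 2)⁻¹ / (1 + √((x ^ 2)⁻¹ / (2 * π)) * √(1 + 4 * ((x ^ 2)⁻¹) ^ 2)) = u c x := by
    rw [sqrt_one_add hx, sqrt_t hc hc2 hx]
    unfold u v q
    field_simp
    ring
  unfold R1 α
  rw [hu, eq_div_iff (by positivity), ← Real.sqrt_sq (by positivity : 0 ≤ c * x),
    ← Real.sqrt_mul' _ (by positivity)]
  congr 1
  rw [← hc2]
  field_simp
  ring

end FrontAux

open FrontAux in
/-- As `t → ∞`,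
`R₀(t) − R₁(α(t)) = (π/3)t⁻² + (1/(2√2))√π·t^(-5/2) − (11/15)π²t⁻³
  − (11/(6√2))π^(3/2)t^(-7/2) + (103π³/70 − 5π/8)t⁻⁴ + O(t^(-9/2))`. -/
theorem front_radius_asymptotics :
    (fun t : ℝ =>
        R0 t - R1 (α t) -
          (π / 3 * t ^ (-2 : ℝ) + 1 / (2 * Real.sqrt 2) * Real.sqrt π * t ^ (-(5 : ℝ) / 2) -
            11 / 15 * π ^ 2 * t ^ (-3 : ℝ) -
            11 / (6 * Real.sqrt 2) * π ^ ((3 : ℝ) / 2) * t ^ (-(7 : ℝ) / 2) +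
            (103 * π ^ 3 / 70 - 5 * π / 8) * t ^ (-4 : ℝ))) =O[atTop]
      fun t : ℝ => t ^ (-(9 : ℝ) / 2) := by
  have hp := Real.pi_pos
  obtain ⟨c, hcd⟩ : ∃ c, c = √2 * √π := ⟨_, rfl⟩
  have hc : 0 < c := by rw [hcd]; positivity
  have s2 : √2 ^ 2 = (2 : ℝ) := Real.sq_sqrt (by norm_num)
  have sp : √π ^ 2 = π := Real.sq_sqrt hp.le
  have hc2 : c ^ 2 = 2 * π := by rw [hcd, mul_pow, s2, sp]
  obtain ⟨C, hC⟩ := core hc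
  apply IsBigO.of_bound C
  filter_upwards [eventually_ge_atTop 1] with t ht
  have ht0 : 0 < t := by linarith
  obtain ⟨x, hxd⟩ : ∃ x, x = t ^ (-(1 / 2) : ℝ) := ⟨_, rfl⟩
  have hx : 0 < x := by rw [hxd]; positivity
  have hx1 : x ≤ 1 := by
    rw [hxd]; exact Real.rpow_le_one_of_one_le_of_nonpos ht (by norm_num)
  have hpow : ∀ n : ℕ, x ^ n = t ^ (-(1 / 2) * n : ℝ) := fun n => by
    rw [hxd, Real.rpow_mul_natCast ht0.le]
  have p4 : t ^ (-2 : ℝ) = x ^ 4 := by rw [hpow]; norm_num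
  have p5 : t ^ (-(5 : ℝ) / 2) = x ^ 5 := by rw [hpow]; norm_num
  have p6 : t ^ (-3 : ℝ) = x ^ 6 := by rw [hpow]; norm_num
  have p7 : t ^ (-(7 : ℝ) / 2) = x ^ 7 := by rw [hpow]; norm_num
  have p8 : t ^ (-4 : ℝ) = x ^ 8 := by rw [hpow]; norm_num
  have p9 : t ^ (-(9 : ℝ) / 2) = x ^ 9 := by rw [hpow]; norm_num
  have htx : t = (x ^ 2)⁻¹ := by
    rw [hpow, ← Real.rpow_neg ht0.le]; norm_num
  have hp32 : π ^ ((3 : ℝ) / 2) = √π ^ 3 := by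
    rw [Real.sqrt_eq_rpow, ← Real.rpow_mul_natCast hp.le]; norm_num
  rw [p4, p5, p6, p7, p8, p9, hp32, htx, R0_eq hc hc2 hx, R1_eq hc hc2 hx, Real.norm_eq_abs,
    Real.norm_eq_abs, abs_of_pos (by positivity : 0 < x ^ 9)]
  have hT : π / 3 * x ^ 4 + 1 / (2 * √2) * √π * x ^ 5 - 11 / 15 * π ^ 2 * x ^ 6 -
      11 / (6 * √2) * √π ^ 3 * x ^ 7 + (103 * π ^ 3 / 70 - 5 * π / 8) * x ^ 8 = T c x := by
    have k1 : 1 / (2 * √2) * √π = c / 4 := by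
      rw [hcd]; field_simp; linear_combination -2 * s2
    have k2 : 11 / (6 * √2) * √π ^ 3 = 11 / 24 * c ^ 3 := by
      rw [hcd]; field_simp
      linear_combination 6 * (-(√2 ^ 2) - 2) * s2
    have k3 : π = c ^ 2 / 2 := by linarith
    rw [k1, k2, k3]
    unfold T
    ring
  rw [hT, ← sub_div]
  exact hC x hx hx1
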